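/- Let H be a complex Hilbert space and T₁, T₂ commuting unitary operators on H. Let F : ℝ² → ℝ be a continuous, (2π,2π)-periodic function with F(P) > 0 for all P, and let c_k and α_k be the Fourier coefficients of F^{-1/2} and F^{1/2} respectively. Assume (c_k) ∈ ℓ¹(ℤ²) and (α_k) ∈ ℓ¹(ℤ²). Then the bounded operators X = Σ_{m∈ℤ²} c_m T₁^{m₁}T₂^{m₂} and Y = Σ_{m∈ℤ²} α_m T₁^{m₁}T₂^{m₂} (both series converging in operator norm) satisfy X Y = Y X = Id_H; in particular X is boundedly invertible with X^{-1} = Y. -/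

import Mathlib

open Real Complex
open UnitAddTorus MeasureTheory

section Uniqueness

noncomputable local instance : MeasureSpace UnitAddCircle := ⟨AddCircle.haarAddCircle⟩

local instance : IsProbabilityMeasure (volume : Measure UnitAddCircle) :=
  inferInstanceAs (IsProbabilityMeasure AddCircle.haarAddCircle)

/-- The coefficients of a uniformly convergent trigonometric series on a torus are determined by
its sum. -/
theorem UnitAddTorus.hasSum_mFourier_unique {d : Type*} [Fintype d] {a b : (d → ℤ) → ℂ}
    {f : C(UnitAddTorus d, ℂ)} (ha : HasSum (fun k => a k • mFourier k) f)
    (hb : HasSum (fun k => b k • mFourier k) f) : a = b := by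
  have key : ∀ {a : (d → ℤ) → ℂ}, HasSum (fun k => a k • mFourier k) f →
      ∀ k, a k = inner ℂ (mFourierLp 2 k) (ContinuousMap.toLp (E := ℂ) 2 volume ℂ f) := by
    intro a ha k
    have h := (innerSL ℂ (mFourierLp 2 k)).hasSum
      ((ContinuousMap.toLp (E := ℂ) 2 volume ℂ).hasSum ha)
    refine HasSum.unique ?_ h
    refine (hasSum_ite_eq k (a k)).congr_fun fun n => ?_
    simp only [map_smul, innerSL_apply_apply]
    have := orthonormal_iff_ite.mp (orthonormal_mFourier (d := d)) k n
    rw [this]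
    by_cases hn : n = k
    · simp [hn]
    · simp [hn, Ne.symm hn]
  funext k
  rw [key ha, key hb]

end Uniqueness

/-- For a bounded multiplicative family `U`, the product of two absolutely convergent series in `U`
is the series whose coefficients are the convolution of the two coefficient families. -/
theorem hasSum_convolution_smul {G A : Type*} [AddCommGroup G] [NormedRing A]
    [NormedAlgebra ℂ A] [CompleteSpace A] {U : G → A} (hU : ∀ m n, U (m + n) = U m * U n)
    (hU1 : ∀ m, ‖U m‖ ≤ 1) {a b : G → ℂ} (ha : Summable fun k => ‖a k‖)
    (hb : Summable fun k => ‖b k‖) :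
    HasSum (fun k => (∑' n, a (k - n) * b n) • U k)
      ((∑' m, a m • U m) * ∑' n, b n • U n) := by
  have bound : ∀ {a : G → ℂ}, (Summable fun k => ‖a k‖) → Summable fun k => ‖a k • U k‖ := by
    intro a ha
    refine ha.of_nonneg_of_le (fun _ => norm_nonneg _) fun k => ?_
    rw [norm_smul]
    exact mul_le_of_le_one_right (norm_nonneg _) (hU1 k)
  let e : G × G ≃ G × G :=
    { toFun := fun p => (p.1 - p.2, p.2)
      invFun := fun p => (p.1 + p.2, p.2)
      left_inv := fun p => by simp
      right_inv := fun p => by simp }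
  have hab : Summable fun p : G × G => a (p.1 - p.2) * b p.2 :=
    e.summable_iff.mpr (summable_mul_of_summable_norm ha hb)
  have hs : HasSum (fun p : G × G => (a (p.1 - p.2) * b p.2) • U p.1)
      ((∑' m, a m • U m) * ∑' n, b n • U n) := by
    rw [tsum_mul_tsum_of_summable_norm (bound ha) (bound hb)]
    have h := e.hasSum_iff.mpr (summable_mul_of_summable_norm (bound ha) (bound hb)).hasSum
    refine h.congr_fun fun p => ?_
    simp only [e, Equiv.coe_fn_mk, Function.comp_apply]
    rw [smul_mul_smul_comm, ← hU, sub_add_cancel]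
  exact hs.prod_fiberwise fun k => (hab.prod_factor k).hasSum.smul_const (U k)

theorem zpow_trans_zpow_add {H : Type*} [NormedAddCommGroup H] [InnerProductSpace ℂ H]
    {T₁ T₂ : H ≃ₗᵢ[ℂ] H} (hcomm : Commute T₁ T₂) (m n : ℤ × ℤ) :
    ((T₂ ^ (m + n).2).trans (T₁ ^ (m + n).1)).toLinearIsometry.toContinuousLinearMap =
      ((T₂ ^ m.2).trans (T₁ ^ m.1)).toLinearIsometry.toContinuousLinearMap *
        ((T₂ ^ n.2).trans (T₁ ^ n.1)).toLinearIsometry.toContinuousLinearMap := by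
  have h : T₁ ^ (m + n).1 * T₂ ^ (m + n).2 = (T₁ ^ m.1 * T₂ ^ m.2) * (T₁ ^ n.1 * T₂ ^ n.2) := by
    rw [Prod.fst_add, Prod.snd_add, zpow_add, zpow_add, mul_assoc, mul_assoc,
      ← mul_assoc (T₁ ^ n.1), ← mul_assoc (T₂ ^ m.2), (hcomm.zpow_zpow n.1 m.2).eq]
  ext v
  exact DFunLike.congr_fun h v

/-- Fourier coefficients on the two-dimensional torus as iterated integrals over `[0, 2π]`. -/
theorem UnitAddTorus.mFourierCoeff_fin_two (f : UnitAddTorus (Fin 2) → ℂ) (hf : Continuous f)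
    (n : Fin 2 → ℤ) :
    mFourierCoeff f n = ((1 / (2 * π) ^ 2 : ℝ) : ℂ) *
      ∫ x in (0 : ℝ)..(2 * π), ∫ y in (0 : ℝ)..(2 * π),
        Complex.exp (-(Complex.I * ((x : ℂ) * (n 0 : ℂ) + (y : ℂ) * (n 1 : ℂ)))) *
          f ![((x / (2 * π) : ℝ) : UnitAddCircle), ((y / (2 * π) : ℝ) : UnitAddCircle)] := by
  have hpi : (2 * π) ≠ 0 := by positivity
  have hset : {x : Fin 2 → ℝ | ∀ i, x i ∈ Set.Ioc ((0 : Fin 2 → ℝ) i) ((0 : Fin 2 → ℝ) i + 1)} =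
      MeasurableEquiv.finTwoArrow ⁻¹' (Set.Ioc (0 : ℝ) 1 ×ˢ Set.Ioc (0 : ℝ) 1) := by
    ext x; simp [Fin.forall_fin_two, MeasurableEquiv.finTwoArrow]
  let h : ℝ × ℝ → ℂ := fun p =>
    mFourier (-n) ![(p.1 : UnitAddCircle), (p.2 : UnitAddCircle)] •
      f ![(p.1 : UnitAddCircle), (p.2 : UnitAddCircle)]
  have hq : Continuous fun p : ℝ × ℝ => (![(p.1 : UnitAddCircle), (p.2 : UnitAddCircle)] :
      UnitAddTorus (Fin 2)) := by
    refine continuous_pi fun i => ?_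
    fin_cases i
    · exact (AddCircle.continuous_mk' 1).comp continuous_fst
    · exact (AddCircle.continuous_mk' 1).comp continuous_snd
  have hcont : Continuous h := ((mFourier (-n)).continuous.comp hq).smul (hf.comp hq)
  rw [mFourierCoeff_eq_integral f n 0, hset]
  have := (volume_preserving_finTwoArrow ℝ).setIntegral_preimage_emb
    (MeasurableEquiv.measurableEmbedding _) h (Set.Ioc (0 : ℝ) 1 ×ˢ Set.Ioc (0 : ℝ) 1)
  have hcoe : ∀ x : Fin 2 → ℝ, h (MeasurableEquiv.finTwoArrow x) =
      mFourier (-n) (fun i => (x i : UnitAddCircle)) • f (fun i => (x i : UnitAddCircle)) := by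
    intro x
    have : (![(x 0 : UnitAddCircle), (x 1 : UnitAddCircle)] : UnitAddTorus (Fin 2)) =
        fun i => (x i : UnitAddCircle) := by
      funext i; fin_cases i <;> rfl
    simp only [h, MeasurableEquiv.finTwoArrow_apply, this]
  simp only [hcoe] at this
  rw [this, Measure.volume_eq_prod, setIntegral_prod]
  · simp only [← intervalIntegral.integral_of_le zero_le_one]
    have hexp : ∀ x y : ℝ, h (x / (2 * π), y / (2 * π)) =
        Complex.exp (-(Complex.I * ((x : ℂ) * (n 0 : ℂ) + (y : ℂ) * (n 1 : ℂ)))) *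
          f ![((x / (2 * π) : ℝ) : UnitAddCircle), ((y / (2 * π) : ℝ) : UnitAddCircle)] := by
      intro x y
      have hpi' : (π : ℂ) ≠ 0 := by exact_mod_cast Real.pi_ne_zero
      simp only [h, mFourier, ContinuousMap.coe_mk, Fin.prod_univ_two, fourier_coe_apply,
        smul_eq_mul, Matrix.cons_val_zero, Matrix.cons_val_one, Pi.neg_apply, ← Complex.exp_add]
      congr 2
      push_cast
      field_simp
      ring
    simp only [← hexp]
    have hin : ∀ x : ℝ, ∫ y in (0 : ℝ)..(2 * π), h (x, y / (2 * π)) =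
        (2 * π) • ∫ y in (0 : ℝ)..1, h (x, y) := by
      intro x
      rw [intervalIntegral.integral_comp_div (fun y => h (x, y)) hpi, zero_div, div_self hpi]
    simp only [hin]
    rw [intervalIntegral.integral_comp_div
      (fun x => (2 * π) • ∫ y in (0 : ℝ)..1, h (x, y)) hpi, zero_div, div_self hpi,
      intervalIntegral.integral_smul]
    simp only [Complex.real_smul]
    have hpi' : (π : ℂ) ≠ 0 := by exact_mod_cast Real.pi_ne_zero
    push_cast
    field_simp
  · rw [← Measure.volume_eq_prod]
    exact (hcont.continuousOn.integrableOn_compact (isCompact_Icc.prod isCompact_Icc)).mono_set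
      (Set.prod_mono Set.Ioc_subset_Icc_self Set.Ioc_subset_Icc_self)

/-- A continuous doubly `2π`-periodic function descends to the torus. -/
theorem UnitAddTorus.exists_lift_of_periodic {g : ℝ × ℝ → ℂ} (hg : Continuous g)
    (hper : ∀ P : ℝ × ℝ, g (P.1 + 2 * π, P.2) = g P ∧ g (P.1, P.2 + 2 * π) = g P) :
    ∃ f : C(UnitAddTorus (Fin 2), ℂ), ∀ x y : ℝ,
      f ![((x / (2 * π) : ℝ) : UnitAddCircle), ((y / (2 * π) : ℝ) : UnitAddCircle)] = g (x, y) := by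
  have hpi : (2 * π) ≠ 0 := by positivity
  let q : C(Fin 2 → ℝ, UnitAddTorus (Fin 2)) :=
    ⟨fun x i => (x i : UnitAddCircle), continuous_pi fun i =>
      (AddCircle.continuous_mk' 1).comp (continuous_apply i)⟩
  have hq : Topology.IsQuotientMap q :=
    (IsOpenQuotientMap.piMap fun _ : Fin 2 =>
      QuotientAddGroup.isOpenQuotientMap_mk (G := ℝ)
        (N := AddSubgroup.zmultiples (1 : ℝ))).isQuotientMap
  let G : C(Fin 2 → ℝ, ℂ) := ⟨fun x => g (x 0 * (2 * π), x 1 * (2 * π)), by fun_prop⟩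
  have hG : Function.FactorsThrough G q := by
    intro x y hxy
    have h1 : ∀ y, Function.Periodic (fun x => g (x, y)) (2 * π) := fun y x => (hper (x, y)).1
    have h2 : ∀ x, Function.Periodic (fun y => g (x, y)) (2 * π) := fun x y => (hper (x, y)).2
    have hint : ∀ i, ∃ k : ℤ, y i = x i + k := by
      intro i
      obtain ⟨k, hk⟩ := AddSubgroup.mem_zmultiples_iff.mp
        (QuotientAddGroup.eq.mp (congrFun hxy i : (x i : UnitAddCircle) = y i))
      refine ⟨k, ?_⟩
      simp only [zsmul_eq_mul, mul_one] at hk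
      linarith
    obtain ⟨k, hk⟩ := hint 0
    obtain ⟨l, hl⟩ := hint 1
    simp only [G, ContinuousMap.coe_mk, hk, hl, add_mul]
    exact ((h2 _).int_mul l _).symm.trans ((h1 _).int_mul k _).symm
  refine ⟨hq.lift G hG, fun x y => ?_⟩
  have h : hq.lift G hG (q ![x / (2 * π), y / (2 * π)]) = G ![x / (2 * π), y / (2 * π)] :=
    DFunLike.congr_fun (hq.lift_comp G hG) _
  have hqv : q ![x / (2 * π), y / (2 * π)] =
      ![((x / (2 * π) : ℝ) : UnitAddCircle), ((y / (2 * π) : ℝ) : UnitAddCircle)] := by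
    funext i
    fin_cases i <;> rfl
  rw [← hqv, h]
  simp [G, hpi]

/-- A continuous doubly `2π`-periodic function with absolutely summable Fourier coefficients descends
to the torus, where it is the uniform sum of its Fourier series. -/
theorem UnitAddTorus.exists_hasSum_of_periodic {g : ℝ × ℝ → ℂ} (hg : Continuous g)
    (hper : ∀ P : ℝ × ℝ, g (P.1 + 2 * π, P.2) = g P ∧ g (P.1, P.2 + 2 * π) = g P)
    {a : ℤ × ℤ → ℂ}
    (ha : ∀ k : ℤ × ℤ, a k = ((1 / (2 * π) ^ 2 : ℝ) : ℂ) *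
      ∫ P₁ in (0 : ℝ)..(2 * π), ∫ P₂ in (0 : ℝ)..(2 * π),
        Complex.exp (-(Complex.I * ((P₁ : ℂ) * (k.1 : ℂ) + (P₂ : ℂ) * (k.2 : ℂ)))) * g (P₁, P₂))
    (hsum : Summable fun k => ‖a k‖) :
    ∃ f : C(UnitAddTorus (Fin 2), ℂ), (∀ x y : ℝ,
      f ![((x / (2 * π) : ℝ) : UnitAddCircle), ((y / (2 * π) : ℝ) : UnitAddCircle)] = g (x, y)) ∧
      HasSum (fun k : ℤ × ℤ => a k • mFourier ![k.1, k.2]) f := by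
  obtain ⟨f, hf⟩ := exists_lift_of_periodic hg hper
  have hcoeff : mFourierCoeff f = a ∘ finTwoArrowEquiv ℤ := by
    funext n
    rw [mFourierCoeff_fin_two f f.continuous n]
    simp only [hf, Function.comp_apply, ha]
    rfl
  refine ⟨f, hf, ?_⟩
  have h := hasSum_mFourier_series_of_summable (f := f)
    (hcoeff ▸ (finTwoArrowEquiv ℤ).summable_iff.mpr hsum.of_norm)
  rw [hcoeff] at h
  exact (finTwoArrowEquiv ℤ).symm.hasSum_iff.mpr h

/-- If two continuous doubly `2π`-periodic functions are mutually inverse, then so are their sequences of Fourier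
coefficients with respect to convolution. -/
theorem tsum_convolution_fourierCoeff_eq_ite {g h : ℝ × ℝ → ℂ} (hg : Continuous g)
    (hh : Continuous h) (hgh : ∀ P, g P * h P = 1)
    (hgper : ∀ P : ℝ × ℝ, g (P.1 + 2 * π, P.2) = g P ∧ g (P.1, P.2 + 2 * π) = g P)
    (hhper : ∀ P : ℝ × ℝ, h (P.1 + 2 * π, P.2) = h P ∧ h (P.1, P.2 + 2 * π) = h P)
    {a b : ℤ × ℤ → ℂ}
    (ha : ∀ k : ℤ × ℤ, a k = ((1 / (2 * π) ^ 2 : ℝ) : ℂ) *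
      ∫ P₁ in (0 : ℝ)..(2 * π), ∫ P₂ in (0 : ℝ)..(2 * π),
        Complex.exp (-(Complex.I * ((P₁ : ℂ) * (k.1 : ℂ) + (P₂ : ℂ) * (k.2 : ℂ)))) * g (P₁, P₂))
    (hb : ∀ k : ℤ × ℤ, b k = ((1 / (2 * π) ^ 2 : ℝ) : ℂ) *
      ∫ P₁ in (0 : ℝ)..(2 * π), ∫ P₂ in (0 : ℝ)..(2 * π),
        Complex.exp (-(Complex.I * ((P₁ : ℂ) * (k.1 : ℂ) + (P₂ : ℂ) * (k.2 : ℂ)))) * h (P₁, P₂))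
    (hasum : Summable fun k => ‖a k‖) (hbsum : Summable fun k => ‖b k‖) (k : ℤ × ℤ) :
    ∑' n, a (k - n) * b n = if k = 0 then 1 else 0 := by
  obtain ⟨f₁, hf₁, hs₁⟩ := exists_hasSum_of_periodic hg hgper ha hasum
  obtain ⟨f₂, hf₂, hs₂⟩ := exists_hasSum_of_periodic hh hhper hb hbsum
  have hpi : (2 * π) ≠ 0 := by positivity
  have hmul : f₁ * f₂ = mFourier 0 := by
    rw [mFourier_zero]
    ext z
    obtain ⟨x, hx⟩ := QuotientAddGroup.mk_surjective (z 0)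
    obtain ⟨y, hy⟩ := QuotientAddGroup.mk_surjective (z 1)
    have hz : z = ![((x * (2 * π) / (2 * π) : ℝ) : UnitAddCircle),
        ((y * (2 * π) / (2 * π) : ℝ) : UnitAddCircle)] := by
      rw [mul_div_cancel_right₀ _ hpi, mul_div_cancel_right₀ _ hpi]
      funext i
      fin_cases i
      · exact hx.symm
      · exact hy.symm
    rw [hz, ContinuousMap.mul_apply, hf₁, hf₂, hgh, ContinuousMap.one_apply]
  have hadd : ∀ m n : ℤ × ℤ, mFourier ![(m + n).1, (m + n).2] =
      mFourier ![m.1, m.2] * mFourier ![n.1, n.2] := by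
    intro m n
    ext z
    rw [ContinuousMap.mul_apply, ← mFourier_add]
    congr 2
    simp
  have hconv := hasSum_convolution_smul (A := C(UnitAddTorus (Fin 2), ℂ))
    (U := fun k : ℤ × ℤ => mFourier ![k.1, k.2]) hadd (fun _ => mFourier_norm.le) hasum hbsum
  rw [hs₁.tsum_eq, hs₂.tsum_eq, hmul] at hconv
  have hconv' := (finTwoArrowEquiv ℤ).hasSum_iff.mpr hconv
  have hdelta : HasSum (fun k : Fin 2 → ℤ => (if k = 0 then (1 : ℂ) else 0) • mFourier k)
      (mFourier 0) := by
    refine (hasSum_ite_eq 0 (mFourier 0)).congr_fun fun k => ?_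
    split_ifs with hk
    · rw [hk, one_smul]
    · exact zero_smul ℂ (mFourier k)
  have huniq := hasSum_mFourier_unique
    (a := fun k => ∑' n, a (finTwoArrowEquiv ℤ k - n) * b n)
    (hconv'.congr_fun fun k => by
      rw [Function.comp_apply]
      congr 2
      exact ((finTwoArrowEquiv ℤ).symm_apply_apply k).symm) hdelta
  have := congrFun huniq ((finTwoArrowEquiv ℤ).symm k)
  simp only [Equiv.apply_symm_apply] at this
  rw [this]
  refine if_congr ?_ rfl rfl
  rw [Equiv.symm_apply_eq]
  rfl

/-- Coefficient families that are inverse for convolution give inverse elements of the algebra. -/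
theorem tsum_smul_mul_tsum_smul_eq_one {G A : Type*} [AddCommGroup G] [DecidableEq G]
    [NormedRing A] [NormedAlgebra ℂ A] [CompleteSpace A] {U : G → A}
    (hU : ∀ m n, U (m + n) = U m * U n) (hU0 : U 0 = 1)
    (hU1 : ∀ m, ‖U m‖ ≤ 1) {a b : G → ℂ} (ha : Summable fun k => ‖a k‖)
    (hb : Summable fun k => ‖b k‖)
    (hab : ∀ k, ∑' n, a (k - n) * b n = if k = 0 then 1 else 0) :
    (∑' m, a m • U m) * ∑' n, b n • U n = 1 := by
  refine (hasSum_convolution_smul hU hU1 ha hb).unique ?_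
  refine (hasSum_ite_eq 0 (1 : A)).congr_fun fun k => ?_
  rw [hab]
  split_ifs with hk <;> simp [hk, hU0]

/-- For commuting unitaries `T₁, T₂` on a complex Hilbert space `H` and a continuous,
`(2π,2π)`-periodic, strictly positive `F : ℝ² → ℝ` whose Fourier coefficients
`c_k` (of `F^{-1/2}`) and `α_k` (of `F^{1/2}`) are both in `ℓ¹(ℤ²)`, the bounded
operators `X = Σ_m c_m T₁^{m₁}T₂^{m₂}` and `Y = Σ_m α_m T₁^{m₁}T₂^{m₂}` satisfy
`XY = YX = Id_H`; in particular `X` is boundedly invertible with `X⁻¹ = Y`. -/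
theorem stmt11 {H : Type*} [NormedAddCommGroup H] [InnerProductSpace ℂ H] [CompleteSpace H]
    (T₁ T₂ : H ≃ₗᵢ[ℂ] H) (hcomm : ∀ v : H, T₁ (T₂ v) = T₂ (T₁ v))
    (F : ℝ × ℝ → ℝ) (hFcont : Continuous F)
    (hFper : ∀ P : ℝ × ℝ, F (P.1 + 2 * π, P.2) = F P ∧ F (P.1, P.2 + 2 * π) = F P)
    (hFpos : ∀ P : ℝ × ℝ, 0 < F P)
    (c : ℤ × ℤ → ℂ)
    (hc : ∀ k : ℤ × ℤ, c k = ((1 / (2 * π) ^ 2 : ℝ) : ℂ) *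
      ∫ P₁ in (0 : ℝ)..(2 * π), ∫ P₂ in (0 : ℝ)..(2 * π),
        Complex.exp (-(Complex.I * ((P₁ : ℂ) * (k.1 : ℂ) + (P₂ : ℂ) * (k.2 : ℂ)))) /
          ((Real.sqrt (F (P₁, P₂)) : ℝ) : ℂ))
    (α : ℤ × ℤ → ℂ)
    (hα : ∀ k : ℤ × ℤ, α k = ((1 / (2 * π) ^ 2 : ℝ) : ℂ) *
      ∫ P₁ in (0 : ℝ)..(2 * π), ∫ P₂ in (0 : ℝ)..(2 * π),
        Complex.exp (-(Complex.I * ((P₁ : ℂ) * (k.1 : ℂ) + (P₂ : ℂ) * (k.2 : ℂ)))) *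
          ((Real.sqrt (F (P₁, P₂)) : ℝ) : ℂ))
    (hcl1 : Summable fun k : ℤ × ℤ => ‖c k‖)
    (hαl1 : Summable fun k : ℤ × ℤ => ‖α k‖)
    (X Y : H →L[ℂ] H)
    (hX : X = ∑' m : ℤ × ℤ,
      c m • ((T₂ ^ m.2).trans (T₁ ^ m.1)).toLinearIsometry.toContinuousLinearMap)
    (hY : Y = ∑' m : ℤ × ℤ,
      α m • ((T₂ ^ m.2).trans (T₁ ^ m.1)).toLinearIsometry.toContinuousLinearMap) :
    X.comp Y = ContinuousLinearMap.id ℂ H ∧ Y.comp X = ContinuousLinearMap.id ℂ H := by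
  let U : ℤ × ℤ → H →L[ℂ] H := fun m =>
    ((T₂ ^ m.2).trans (T₁ ^ m.1)).toLinearIsometry.toContinuousLinearMap
  have hU : ∀ m n, U (m + n) = U m * U n :=
    zpow_trans_zpow_add (LinearIsometryEquiv.ext hcomm)
  have hU0 : U 0 = 1 := by
    ext v
    simp [U]
  have hU1 : ∀ m, ‖U m‖ ≤ 1 := fun m => LinearIsometry.norm_toContinuousLinearMap_le _
  have hsqrt : ∀ P, ((√(F P) : ℝ) : ℂ) ≠ 0 := fun P => by
    exact_mod_cast (Real.sqrt_pos.mpr (hFpos P)).ne'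
  have hcont : Continuous fun P => ((√(F P) : ℝ) : ℂ) := by fun_prop
  have hcont' : Continuous fun P => ((√(F P) : ℝ) : ℂ)⁻¹ := hcont.inv₀ hsqrt
  have hper : ∀ P : ℝ × ℝ, ((√(F (P.1 + 2 * π, P.2)) : ℝ) : ℂ) = (√(F P) : ℝ) ∧
      ((√(F (P.1, P.2 + 2 * π)) : ℝ) : ℂ) = (√(F P) : ℝ) := fun P => by
    rw [(hFper P).1, (hFper P).2]
    exact ⟨rfl, rfl⟩
  have hper' : ∀ P : ℝ × ℝ, ((√(F (P.1 + 2 * π, P.2)) : ℝ) : ℂ)⁻¹ = ((√(F P) : ℝ) : ℂ)⁻¹ ∧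
      ((√(F (P.1, P.2 + 2 * π)) : ℝ) : ℂ)⁻¹ = ((√(F P) : ℝ) : ℂ)⁻¹ := fun P => by
    rw [(hper P).1, (hper P).2]
    exact ⟨rfl, rfl⟩
  simp only [div_eq_mul_inv _ ((√(F _) : ℝ) : ℂ)] at hc
  rw [hX, hY]
  exact ⟨tsum_smul_mul_tsum_smul_eq_one hU hU0 hU1 hcl1 hαl1
      (tsum_convolution_fourierCoeff_eq_ite hcont' hcont (fun P => inv_mul_cancel₀ (hsqrt P))
        hper' hper hc hα hcl1 hαl1),
    tsum_smul_mul_tsum_smul_eq_one hU hU0 hU1 hαl1 hcl1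
      (tsum_convolution_fourierCoeff_eq_ite hcont hcont' (fun P => mul_inv_cancel₀ (hsqrt P))
        hper hper' hα hc hαl1 hcl1)⟩
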